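/- Quadrature error on [S, T]: let n ≥ 1 be a natural number, and let x_1, …, x_n ∈ (−1,1) and w_1, …, w_n be the Gauss–Legendre nodes and weights (the zeros of the monic Legendre polynomial p_n and the associated weights). Let N ≥ 20 and let n_1, …, n_6 be integers with 0 ≤ n_j ≤ N, and set f(z) := z · ∏_{j=1}^{6} J_{n_j}(z). Let K ≥ 1 be an integer, let S and T satisfy 0.95 · N^{3/2} · ln(N) + 1 ≤ S < T, and set d := (T−S)/(2K), assuming S − 1 − 2d > 0. Then | ∫_S^T f(z) dz − Σ_{j=0}^{K−1} d · Σ_{i=1}^{n} w_i f(S + d(2j+1) + d x_i) | ≤ π · 2^{−2n−1} · d^{2n} · (3.36)⁶ · (S − 1 − 2d)^{−1}. -/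

import Mathlib

open Polynomial Real Complex

/-- The Bessel function of integer order `n`, defined by the integral representation
`J_n(z) = (1/(2π)) ∫_0^{2π} e^{i z sin θ} e^{i n θ} dθ`. -/
noncomputable def besselJ (n : ℤ) (z : ℂ) : ℂ :=
  (1 / (2 * (Real.pi : ℂ))) * ∫ θ in (0:ℝ)..(2 * Real.pi),
    Complex.exp (Complex.I * z * (Real.sin θ : ℂ)) * Complex.exp (Complex.I * (n : ℂ) * (θ : ℂ))

/-- The monic Legendre polynomial, given by Rodrigues' formula normalized to be monic. -/
noncomputable def legendreMonic (n : ℕ) : Polynomial ℝ :=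
  Polynomial.C ((n.factorial : ℝ) / ((2 * n).factorial : ℝ)) *
    Polynomial.derivative^[n] ((Polynomial.X ^ 2 - 1) ^ n)

/-- Rolle's theorem for a finite set of zeros: between consecutive zeros of `h` there are zeros
of the derivative outside the given set. -/
lemma exists_finset_zeros_deriv {h h' : ℝ → ℝ} (hd : ∀ t, HasDerivAt h (h' t) t) {a b : ℝ}
    (s : Finset ℝ) (hs : ∀ z ∈ s, z ∈ Set.Icc a b ∧ h z = 0) :
    ∃ t : Finset ℝ, (∀ z ∈ t, z ∈ Set.Icc a b ∧ h' z = 0) ∧ s.card ≤ t.card + 1 ∧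
      Disjoint t s := by
  classical
  have key : ∀ u v : ℝ, ∃ z, u ∈ s → v ∈ s → u < v → z ∈ Set.Ioo u v ∧ h' z = 0 := by
    intro u v
    by_cases huv : u ∈ s ∧ v ∈ s ∧ u < v
    · obtain ⟨hu, hv, hlt⟩ := huv
      obtain ⟨z, hz, hz'⟩ := exists_hasDerivAt_eq_zero hlt
        (fun t _ => (hd t).continuousAt.continuousWithinAt)
        ((hs u hu).2.trans (hs v hv).2.symm) (fun t _ => hd t)
      exact ⟨z, fun _ _ _ => ⟨hz, hz'⟩⟩
    · exact ⟨0, fun hu hv hlt => absurd ⟨hu, hv, hlt⟩ huv⟩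
  choose ζ hζ using key
  let t : Finset ℝ := ((s ×ˢ s).filter (fun p => p.1 < p.2)).image (fun p => ζ p.1 p.2)
  refine ⟨t \ s, ?_, ?_, Finset.sdiff_disjoint⟩
  · intro z hz
    obtain ⟨p, hp, rfl⟩ := Finset.mem_image.1 (Finset.mem_sdiff.1 hz).1
    obtain ⟨hp, hlt⟩ := Finset.mem_filter.1 hp
    obtain ⟨hp1, hp2⟩ := Finset.mem_product.1 hp
    obtain ⟨h1, h2⟩ := hζ _ _ hp1 hp2 hlt
    exact ⟨⟨(hs _ hp1).1.1.trans h1.1.le, h1.2.le.trans (hs _ hp2).1.2⟩, h2⟩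
  · refine Finset.card_le_sdiff_of_interleaved fun u hu v hv hlt _ => ?_
    obtain ⟨h1, -⟩ := hζ u v hu hv hlt
    exact ⟨ζ u v, Finset.mem_image.2 ⟨(u, v), by simp [hu, hv, hlt], rfl⟩, h1.1, h1.2⟩

/-- Iterated Rolle theorem along a chain of derivatives. -/
lemma exists_zero_of_card_zeros {a b : ℝ} (m : ℕ) :
    ∀ (g : ℕ → ℝ → ℝ) (_ : ∀ j t, HasDerivAt (g j) (g (j + 1) t) t) (s : Finset ℝ)
      (_ : ∀ z ∈ s, z ∈ Set.Icc a b ∧ g 0 z = 0) (_ : m + 1 ≤ s.card),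
      ∃ ξ ∈ Set.Icc a b, g m ξ = 0 := by
  induction m with
  | zero =>
    intro g _ s hs hc
    obtain ⟨z, hz⟩ := Finset.card_pos.1 hc
    exact ⟨z, hs z hz⟩
  | succ m ih =>
    intro g hg s hs hc
    obtain ⟨t, ht, hcard, -⟩ := exists_finset_zeros_deriv (hg 0) s hs
    exact ih (fun j => g (j + 1)) (fun j => hg (j + 1)) t ht (by omega)

/-- Existence of the Hermite interpolation polynomial with double nodes. -/
lemma exists_hermite_interpolant {n : ℕ} (hn : 1 ≤ n) {x : Fin n → ℝ}
    (hx : Function.Injective x) (u v : Fin n → ℝ) :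
    ∃ H : ℝ[X], H.natDegree ≤ 2 * n - 1 ∧ (∀ i, H.eval (x i) = u i) ∧
      ∀ i, (derivative H).eval (x i) = v i := by
  classical
  have hinj : Set.InjOn x (Finset.univ : Finset (Fin n)) := hx.injOn
  set P := Lagrange.nodal Finset.univ x with hP
  set L := Lagrange.interpolate Finset.univ x u with hL
  have hP' : ∀ i, (derivative P).eval (x i) ≠ 0 := by
    intro i
    rw [hP, Lagrange.eval_nodal_derivative_eval_node_eq (Finset.mem_univ i), Lagrange.eval_nodal]
    exact Finset.prod_ne_zero_iff.2 fun j hj =>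
      sub_ne_zero.2 fun h => (Finset.ne_of_mem_erase hj) (hx h).symm
  set Q := Lagrange.interpolate Finset.univ x
    (fun i => (v i - (derivative L).eval (x i)) / (derivative P).eval (x i)) with hQ
  have hdeg : ∀ r : Fin n → ℝ, (Lagrange.interpolate Finset.univ x r).natDegree ≤ n - 1 := by
    intro r
    have := Lagrange.degree_interpolate_le (s := Finset.univ) (v := x) r hinj
    simpa using natDegree_le_of_degree_le this
  have hPx : ∀ i, P.eval (x i) = 0 := fun i => Lagrange.eval_nodal_at_node (Finset.mem_univ i)
  refine ⟨L + P * Q, ?_, fun i => ?_, fun i => ?_⟩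
  · refine natDegree_add_le_of_degree_le ((hdeg u).trans (by omega)) ?_
    refine natDegree_mul_le.trans ?_
    have h1 : P.natDegree = n := by simp [hP, Lagrange.natDegree_nodal]
    have h2 := hdeg (fun i => (v i - (derivative L).eval (x i)) / (derivative P).eval (x i))
    rw [← hQ] at h2
    omega
  · rw [eval_add, eval_mul, hPx, zero_mul, add_zero, hL,
      Lagrange.eval_interpolate_at_node u hinj (Finset.mem_univ i)]
  · rw [derivative_add, derivative_mul, eval_add, eval_add, eval_mul, eval_mul, hPx, zero_mul,
      add_zero, hQ, Lagrange.eval_interpolate_at_node _ hinj (Finset.mem_univ i),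
      mul_div_cancel₀ _ (hP' i)]
    ring

lemma iterate_derivative_of_monic {p : ℝ[X]} (hp : p.Monic) :
    derivative^[p.natDegree] p = C (p.natDegree.factorial : ℝ) := by
  have h : (derivative^[p.natDegree] p).natDegree = 0 := by
    have := natDegree_iterate_derivative p p.natDegree
    omega
  rw [eq_C_of_natDegree_eq_zero h, coeff_iterate_derivative]
  simp [hp.leadingCoeff, Nat.descFactorial_self]

/-- Pointwise error bound for Hermite interpolation with double nodes. -/
lemma abs_sub_hermite_le {n : ℕ} (hn : 1 ≤ n) {x : Fin n → ℝ} (hx : Function.Injective x)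
    {a b : ℝ} (hmem : ∀ i, x i ∈ Set.Icc a b) (F : ℕ → ℝ → ℝ)
    (hF : ∀ j t, HasDerivAt (F j) (F (j + 1) t) t) {B : ℝ}
    (hB : ∀ t ∈ Set.Icc a b, |F (2 * n) t| ≤ (2 * n).factorial * B) {H : ℝ[X]}
    (hdeg : H.natDegree ≤ 2 * n - 1) (hH : ∀ i, H.eval (x i) = F 0 (x i))
    (hH' : ∀ i, (derivative H).eval (x i) = F 1 (x i)) {y : ℝ} (hy : y ∈ Set.Icc a b) :
    |F 0 y - H.eval y| ≤ B * (Lagrange.nodal Finset.univ x).eval y ^ 2 := by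
  classical
  set P := Lagrange.nodal Finset.univ x with hP
  have hPx : ∀ i, P.eval (x i) = 0 := fun i => Lagrange.eval_nodal_at_node (Finset.mem_univ i)
  by_cases hnode : ∃ i, x i = y
  · obtain ⟨i, rfl⟩ := hnode
    simp [hH, hPx]
  have hPy : P.eval y ≠ 0 := by
    rw [hP, Lagrange.eval_nodal]
    exact Finset.prod_ne_zero_iff.2 fun i _ =>
      sub_ne_zero.2 fun h => hnode ⟨i, h.symm⟩
  set c := (F 0 y - H.eval y) / P.eval y ^ 2 with hc
  set R := H + C c * P ^ 2 with hR
  let φ : ℕ → ℝ → ℝ := fun j t => F j t - (derivative^[j] R).eval t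
  have hφ : ∀ j t, HasDerivAt (φ j) (φ (j + 1) t) t := by
    intro j t
    refine (hF j t).sub ?_
    rw [Function.iterate_succ_apply']
    exact (derivative^[j] R).hasDerivAt t
  let nodes : Finset ℝ := Finset.univ.image x
  have hnodes : nodes.card = n := by
    rw [Finset.card_image_of_injective _ hx, Finset.card_univ, Fintype.card_fin]
  have hynodes : y ∉ nodes := by simpa [nodes] using hnode
  obtain ⟨t, ht, htc, htd⟩ := exists_finset_zeros_deriv (hφ 0) (a := a) (b := b) (insert y nodes)
    (by
      intro z hz
      rcases Finset.mem_insert.1 hz with rfl | hz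
      · refine ⟨hy, ?_⟩
        simp only [φ, hR, Function.iterate_zero, id, eval_add, eval_mul, eval_C, eval_pow, hc]
        field_simp
        ring
      · obtain ⟨i, -, rfl⟩ := Finset.mem_image.1 hz
        exact ⟨hmem i, by simp [φ, hR, hH, hPx]⟩)
  rw [Finset.card_insert_of_notMem hynodes, hnodes] at htc
  have htd' : Disjoint t nodes := htd.mono_right (Finset.subset_insert _ _)
  obtain ⟨ξ, hξ, hξ0⟩ := exists_zero_of_card_zeros (a := a) (b := b) (2 * n - 1)
    (fun j => φ (j + 1)) (fun j => hφ (j + 1)) (t ∪ nodes)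
    (by
      intro z hz
      rcases Finset.mem_union.1 hz with hz | hz
      · exact ht z hz
      · obtain ⟨i, -, rfl⟩ := Finset.mem_image.1 hz
        exact ⟨hmem i, by simp [φ, hR, hH', hPx, derivative_pow]⟩)
    (by rw [Finset.card_union_of_disjoint htd', hnodes]; omega)
  rw [show 2 * n - 1 + 1 = 2 * n by omega] at hξ0
  have hPm : (P ^ 2).Monic := Lagrange.nodal_monic.pow 2
  have hPd : (P ^ 2).natDegree = 2 * n := by
    rw [(Lagrange.nodal_monic (s := Finset.univ) (v := x)).natDegree_pow, Lagrange.natDegree_nodal,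
      Finset.card_univ, Fintype.card_fin]
  have hD : derivative^[2 * n] R = C (c * (2 * n).factorial) := by
    have h2 := iterate_derivative_of_monic hPm
    rw [hPd] at h2
    rw [hR, iterate_map_add, iterate_derivative_eq_zero (by omega : H.natDegree < 2 * n),
      iterate_derivative_C_mul, h2, zero_add, C_mul]
  have hcB : |c| ≤ B := by
    have h1 : F (2 * n) ξ = c * (2 * n).factorial := by
      simpa [φ, hD, sub_eq_zero] using hξ0
    have h2 := hB ξ hξ
    have h3 : (0 : ℝ) < (2 * n).factorial := by positivity
    rw [h1, abs_mul, abs_of_pos h3, mul_comm] at h2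
    exact le_of_mul_le_mul_left h2 h3
  have h4 : F 0 y - H.eval y = c * P.eval y ^ 2 := by
    rw [hc]; field_simp
  rw [h4, abs_mul, abs_of_nonneg (sq_nonneg (P.eval y))]
  gcongr

/-- Error bound for a quadrature rule that is exact in degree at most `2 * n - 1`. -/
lemma abs_quadrature_error_le {n : ℕ} (hn : 1 ≤ n) {x w : Fin n → ℝ}
    (hx : Function.Injective x) (hmem : ∀ i, x i ∈ Set.Icc (-1 : ℝ) 1)
    (hw : ∀ q : ℝ[X], q.natDegree ≤ 2 * n - 1 →
      (∫ y in (-1 : ℝ)..1, q.eval y) = ∑ i : Fin n, w i * q.eval (x i))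
    (F : ℕ → ℝ → ℝ) (hF : ∀ j t, HasDerivAt (F j) (F (j + 1) t) t) {B : ℝ}
    (hB : ∀ t ∈ Set.Icc (-1 : ℝ) 1, |F (2 * n) t| ≤ (2 * n).factorial * B) :
    |(∫ y in (-1 : ℝ)..1, F 0 y) - ∑ i, w i * F 0 (x i)| ≤
      B * ∫ y in (-1 : ℝ)..1, (Lagrange.nodal Finset.univ x).eval y ^ 2 := by
  obtain ⟨H, hdeg, hH, hH'⟩ := exists_hermite_interpolant hn hx (fun i => F 0 (x i))
    (fun i => F 1 (x i))
  have hcont : Continuous (F 0) := continuous_iff_continuousAt.2 fun t => (hF 0 t).continuousAt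
  have hHc : Continuous fun y => H.eval y := H.continuous
  have hPc : Continuous fun y => (Lagrange.nodal Finset.univ x).eval y ^ 2 :=
    (Lagrange.nodal Finset.univ x).continuous.pow 2
  have hsum : ∑ i, w i * F 0 (x i) = ∫ y in (-1 : ℝ)..1, H.eval y := by
    rw [hw H hdeg]
    simp [hH]
  rw [hsum, ← intervalIntegral.integral_sub (hcont.intervalIntegrable _ _)
    (hHc.intervalIntegrable _ _), ← intervalIntegral.integral_const_mul, ← Real.norm_eq_abs]
  refine intervalIntegral.norm_integral_le_of_norm_le (by norm_num) ?_
    ((continuous_const.mul hPc).intervalIntegrable _ _)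
  refine Filter.Eventually.of_forall fun y hy => ?_
  rw [Real.norm_eq_abs]
  exact abs_sub_hermite_le hn hx hmem F hF hB hdeg hH hH' (Set.Ioc_subset_Icc_self hy)

lemma integral_mul_iterate_derivative (n : ℕ) (Q : ℝ[X]) :
    ∀ m ≤ n, (∫ y in (-1 : ℝ)..1, Q.eval y * (derivative^[n] ((X ^ 2 - 1 : ℝ[X]) ^ n)).eval y) =
      (-1) ^ m * ∫ y in (-1 : ℝ)..1,
        (derivative^[m] Q).eval y * (derivative^[n - m] ((X ^ 2 - 1 : ℝ[X]) ^ n)).eval y := by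
  intro m
  induction m with
  | zero => intro _; simp
  | succ m ih =>
    intro hm
    rw [ih (by omega)]
    set W := derivative^[n - (m + 1)] ((X ^ 2 - 1 : ℝ[X]) ^ n) with hW
    have hW' : derivative^[n - m] ((X ^ 2 - 1 : ℝ[X]) ^ n) = derivative W := by
      rw [hW, ← Function.iterate_succ_apply' (f := derivative)]
      congr 2
      omega
    have hdvd : (X ^ 2 - 1 : ℝ[X]) ∣ W :=
      (dvd_pow_self _ (by omega : n - (n - (m + 1)) ≠ 0)).trans
        (pow_sub_dvd_iterate_derivative_pow _ n (n - (m + 1)))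
    obtain ⟨V, hV⟩ := hdvd
    have h1 : W.eval 1 = 0 := by rw [hV]; simp
    have h2 : W.eval (-1) = 0 := by rw [hV]; simp
    rw [hW', intervalIntegral.integral_mul_deriv_eq_deriv_mul
      (fun y _ => (derivative^[m] Q).hasDerivAt y) (fun y _ => W.hasDerivAt y)
      ((derivative (derivative^[m] Q)).continuous.intervalIntegrable _ _)
      ((derivative W).continuous.intervalIntegrable _ _), h1, h2, Function.iterate_succ_apply']
    ring

lemma natDegree_X_sq_sub_one_pow (n : ℕ) :
    ((X ^ 2 - 1 : ℝ[X]) ^ n).Monic ∧ ((X ^ 2 - 1 : ℝ[X]) ^ n).natDegree = 2 * n := by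
  have h : (X ^ 2 - 1 : ℝ[X]).Monic := by
    simpa using monic_X_pow_sub_C (1 : ℝ) two_ne_zero
  have hd : (X ^ 2 - 1 : ℝ[X]).natDegree = 2 := by
    simpa using natDegree_X_pow_sub_C (n := 2) (r := (1 : ℝ))
  exact ⟨h.pow n, by rw [h.natDegree_pow, hd, mul_comm]⟩

lemma legendreMonic_natDegree_le (n : ℕ) : (legendreMonic n).natDegree ≤ n := by
  refine (natDegree_C_mul_le _ _).trans ?_
  have := natDegree_iterate_derivative ((X ^ 2 - 1 : ℝ[X]) ^ n) n
  rw [(natDegree_X_sq_sub_one_pow n).2] at this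
  omega

lemma legendreMonic_coeff_self (n : ℕ) : (legendreMonic n).coeff n = 1 := by
  obtain ⟨hm, hd⟩ := natDegree_X_sq_sub_one_pow n
  have hc : ((X ^ 2 - 1 : ℝ[X]) ^ n).coeff (n + n) = 1 := by
    rw [← two_mul, ← hd]; exact hm.coeff_natDegree
  have hf : (n.factorial : ℝ) * ((n + n).descFactorial n : ℝ) = ((2 * n).factorial : ℝ) := by
    have := Nat.factorial_mul_descFactorial (Nat.le_add_left n n)
    rw [Nat.add_sub_cancel] at this
    rw [two_mul]
    exact_mod_cast this
  have h0 : ((2 * n).factorial : ℝ) ≠ 0 := by positivity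
  rw [legendreMonic, coeff_C_mul, coeff_iterate_derivative, hc, nsmul_eq_mul, mul_one,
    div_mul_eq_mul_div, hf, div_self h0]

lemma prod_odd_div_even (n : ℕ) :
    ∏ i ∈ Finset.range n, (2 * (i : ℝ) + 1) / (2 * i + 2) =
      ((2 * n).factorial : ℝ) / (4 ^ n * (n.factorial : ℝ) ^ 2) := by
  induction n with
  | zero => simp
  | succ n ih =>
    rw [Finset.prod_range_succ, ih, show 2 * (n + 1) = 2 * n + 1 + 1 by ring, Nat.factorial_succ,
      Nat.factorial_succ, Nat.factorial_succ]
    push_cast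
    have h : (n.factorial : ℝ) ≠ 0 := by positivity
    field_simp
    ring

/-- The nodal polynomial of a Gauss rule has squared `L²`-norm at most `π / 4 ^ n`. -/
lemma integral_nodal_sq_le {n : ℕ} (hn : 1 ≤ n) {x w : Fin n → ℝ}
    (hw : ∀ q : ℝ[X], q.natDegree ≤ 2 * n - 1 →
      (∫ y in (-1 : ℝ)..1, q.eval y) = ∑ i : Fin n, w i * q.eval (x i)) :
    (∫ y in (-1 : ℝ)..1, (Lagrange.nodal Finset.univ x).eval y ^ 2) ≤ Real.pi / 4 ^ n := by
  set P := Lagrange.nodal Finset.univ x with hP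
  have hPm : P.Monic := Lagrange.nodal_monic
  have hPd : P.natDegree = n := by simp [hP, Lagrange.natDegree_nodal]
  have hPx : ∀ i, P.eval (x i) = 0 := fun i => Lagrange.eval_nodal_at_node (Finset.mem_univ i)
  have hq : (P - legendreMonic n).natDegree ≤ n - 1 := by
    refine natDegree_le_iff_coeff_eq_zero.2 fun N hN => ?_
    rw [coeff_sub]
    rcases eq_or_lt_of_le (by omega : n ≤ N) with rfl | hlt
    · rw [legendreMonic_coeff_self, ← hPd, hPm.coeff_natDegree, sub_self]
    · rw [coeff_eq_zero_of_natDegree_lt (by omega),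
        coeff_eq_zero_of_natDegree_lt ((legendreMonic_natDegree_le n).trans_lt hlt), sub_self]
  have horth : (∫ y in (-1 : ℝ)..1, (P * (P - legendreMonic n)).eval y) = 0 := by
    rw [hw _ (natDegree_mul_le.trans (by omega))]
    simp [hPx]
  have h1 : (∫ y in (-1 : ℝ)..1, P.eval y ^ 2) =
      ∫ y in (-1 : ℝ)..1, P.eval y * (legendreMonic n).eval y := by
    have hc1 : Continuous fun y => P.eval y ^ 2 := P.continuous.pow 2
    have hc2 : Continuous fun y => P.eval y * (legendreMonic n).eval y :=
      P.continuous.mul (legendreMonic n).continuous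
    rw [← sub_eq_zero, ← intervalIntegral.integral_sub (hc1.intervalIntegrable _ _)
      (hc2.intervalIntegrable _ _), ← horth]
    refine intervalIntegral.integral_congr fun y _ => ?_
    simp only [eval_mul, eval_sub]
    ring
  have h2 : (∫ y in (-1 : ℝ)..1, P.eval y * (legendreMonic n).eval y) =
      (n.factorial : ℝ) / ((2 * n).factorial : ℝ) *
        ∫ y in (-1 : ℝ)..1, P.eval y * (derivative^[n] ((X ^ 2 - 1 : ℝ[X]) ^ n)).eval y := by
    rw [← intervalIntegral.integral_const_mul]
    refine intervalIntegral.integral_congr fun y _ => ?_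
    simp only [legendreMonic, eval_mul, eval_C]
    ring
  have h3 : (∫ y in (-1 : ℝ)..1, P.eval y * (derivative^[n] ((X ^ 2 - 1 : ℝ[X]) ^ n)).eval y) =
      n.factorial * ∫ t in (0 : ℝ)..Real.pi, Real.sin t ^ (2 * n + 1) := by
    have hPn := iterate_derivative_of_monic hPm
    rw [hPd] at hPn
    have hs := integral_sin_pow_odd_mul_cos_pow (a := 0) (b := Real.pi) n 0
    simp only [pow_zero, mul_one, one_mul, Real.cos_zero, Real.cos_pi] at hs
    rw [integral_mul_iterate_derivative n P n le_rfl, hPn, hs, Nat.sub_self,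
      ← intervalIntegral.integral_const_mul, ← intervalIntegral.integral_const_mul]
    refine intervalIntegral.integral_congr fun y _ => ?_
    simp only [Function.iterate_zero, id, eval_C, eval_pow, eval_sub, eval_X, eval_one]
    rw [mul_left_comm, ← mul_pow]
    ring
  have h4 : (∫ t in (0 : ℝ)..Real.pi, Real.sin t ^ (2 * n + 1)) ≤
      Real.pi * (((2 * n).factorial : ℝ) / (4 ^ n * (n.factorial : ℝ) ^ 2)) := by
    rw [← prod_odd_div_even, ← integral_sin_pow_even]
    exact integral_sin_pow_succ_le _
  rw [h1, h2, h3]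
  have h5 : (0 : ℝ) < n.factorial := by positivity
  have h6 : (0 : ℝ) < (2 * n).factorial := by positivity
  calc _ ≤ (n.factorial : ℝ) / ((2 * n).factorial : ℝ) * (n.factorial *
        (Real.pi * (((2 * n).factorial : ℝ) / (4 ^ n * (n.factorial : ℝ) ^ 2)))) := by gcongr
    _ = Real.pi / 4 ^ n := by field_simp

/-- Integral form of the resonance estimate: near the zeros of `x * cos θ + k` the integrand is
of size one, on a set of measure comparable to `1 / √x`. -/
lemma integral_resonance_le {x k : ℝ} (hx : 240 ≤ x) (hk : 0 ≤ k) (hkx : 12 * k ≤ x) :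
    (∫ θ in (0 : ℝ)..Real.pi, x / ((x * Real.cos θ + k) ^ 2 + x)) ≤
      72 / 71 * (Real.pi * (1 / √x) * (1 + 2 * (1 / √x))) := by
  have hx0 : 0 < x := by linarith
  have hD : ∀ θ, 0 < (x * Real.cos θ + k) ^ 2 + x := fun θ => by positivity
  have hr : 0 < √x := Real.sqrt_pos.2 hx0
  have hrr : √x ^ 2 = x := Real.sq_sqrt hx0.le
  set A := ∫ θ in (0 : ℝ)..Real.pi, x / ((x * Real.cos θ + k) ^ 2 + x) with hA
  have hcA : Continuous fun θ : ℝ => x / ((x * Real.cos θ + k) ^ 2 + x) :=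
    Continuous.div (by fun_prop) (by fun_prop) fun θ => (hD θ).ne'
  have hcS : Continuous fun θ : ℝ => x * Real.sin θ / ((x * Real.cos θ + k) ^ 2 + x) :=
    Continuous.div (by fun_prop) (by fun_prop) fun θ => (hD θ).ne'
  have hS : (∫ θ in (0 : ℝ)..Real.pi, x * Real.sin θ / ((x * Real.cos θ + k) ^ 2 + x)) ≤
      Real.pi * (1 / √x) := by
    have hderiv : ∀ θ ∈ Set.uIcc 0 Real.pi,
        HasDerivAt (fun θ => -(1 / √x) * Real.arctan ((x * Real.cos θ + k) / √x))
          (x * Real.sin θ / ((x * Real.cos θ + k) ^ 2 + x)) θ := by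
      intro θ _
      have h1 : HasDerivAt (fun θ => (x * Real.cos θ + k) / √x) (x * -Real.sin θ / √x) θ :=
        (((Real.hasDerivAt_cos θ).const_mul x).add_const k).div_const _
      refine (h1.arctan.const_mul (-(1 / √x))).congr_deriv ?_
      have h2 := (hD θ).ne'
      have h3 : 1 + ((x * Real.cos θ + k) / √x) ^ 2 = ((x * Real.cos θ + k) ^ 2 + x) / x := by
        rw [div_pow, hrr]; field_simp; ring
      rw [h3]
      field_simp
      rw [hrr]
    rw [intervalIntegral.integral_eq_sub_of_hasDerivAt hderiv (hcS.intervalIntegrable _ _)]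
    have h1 := Real.neg_pi_div_two_lt_arctan ((x * Real.cos Real.pi + k) / √x)
    have h2 := Real.arctan_lt_pi_div_two ((x * Real.cos 0 + k) / √x)
    have h3 : 0 < 1 / √x := by positivity
    nlinarith
  have hpt : ∀ θ ∈ Set.Icc 0 Real.pi, x / ((x * Real.cos θ + k) ^ 2 + x) ≤
      x * Real.sin θ / ((x * Real.cos θ + k) ^ 2 + x) +
        (2 / x + 1 / 72 * (x / ((x * Real.cos θ + k) ^ 2 + x))) := by
    intro θ hθ
    have hs0 := Real.sin_nonneg_of_mem_Icc hθ
    have hs1 := Real.sin_le_one θ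
    have hsc := Real.sin_sq_add_cos_sq θ
    set c := Real.cos θ
    set s := Real.sin θ
    set D := (x * c + k) ^ 2 + x with hDdef
    have hD0 : 0 < D := hD θ
    have e : x * s / D + (2 / x + 1 / 72 * (x / D)) =
        (x * s + (2 * D / x + x / 72)) / D := by field_simp
    rw [e]
    refine div_le_div_of_nonneg_right ?_ hD0.le
    have h1 : x * c ^ 2 ≤ 2 * D / x + x / 72 := by
      rw [← sub_nonneg]
      have : 2 * D / x + x / 72 - x * c ^ 2 =
          ((x * c + 2 * k) ^ 2 + (x ^ 2 - 144 * k ^ 2) / 72 + 2 * x) / x := by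
        rw [hDdef]; field_simp; ring
      rw [this]
      have : 0 ≤ x ^ 2 - 144 * k ^ 2 := by nlinarith
      positivity
    nlinarith [mul_nonneg hx0.le (mul_nonneg hs0 (sub_nonneg.2 hs1))]
  have hi2 : Continuous fun θ : ℝ => 1 / 72 * (x / ((x * Real.cos θ + k) ^ 2 + x)) :=
    continuous_const.mul hcA
  have hi1 : Continuous fun θ : ℝ => 2 / x + 1 / 72 * (x / ((x * Real.cos θ + k) ^ 2 + x)) :=
    continuous_const.add hi2
  have hi0 : Continuous fun θ : ℝ => x * Real.sin θ / ((x * Real.cos θ + k) ^ 2 + x) +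
      (2 / x + 1 / 72 * (x / ((x * Real.cos θ + k) ^ 2 + x))) := hcS.add hi1
  have hmono := intervalIntegral.integral_mono_on (μ := MeasureTheory.volume) Real.pi_pos.le
    (hcA.intervalIntegrable _ _) (hi0.intervalIntegrable _ _) hpt
  rw [intervalIntegral.integral_add (hcS.intervalIntegrable _ _) (hi1.intervalIntegrable _ _),
    intervalIntegral.integral_add intervalIntegrable_const (hi2.intervalIntegrable _ _),
    intervalIntegral.integral_const_mul, intervalIntegral.integral_const, ← hA, sub_zero,
    smul_eq_mul] at hmono
  have h2x : 2 / x = 2 * (1 / √x) ^ 2 := by rw [div_pow, hrr]; ring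
  rw [h2x] at hmono
  nlinarith

/-- Non-stationary phase identity over a full period, in terms of norms. -/
lemma norm_integral_le_of_corrector {E E' v v' : ℝ → ℂ} {g : ℝ → ℝ} {a b : ℝ} (hab : a ≤ b)
    (hE : ∀ θ, HasDerivAt E (E' θ) θ) (hv : ∀ θ, HasDerivAt v (v' θ) θ)
    (hE'c : Continuous E') (hv'c : Continuous v') (hg : Continuous g)
    (hper : v b * E b = v a * E a)
    (hle : ∀ θ, ‖E θ - (v' θ * E θ + v θ * E' θ)‖ ≤ g θ) :
    ‖∫ θ in a..b, E θ‖ ≤ ∫ θ in a..b, g θ := by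
  have hEc : Continuous E := continuous_iff_continuousAt.2 fun t => (hE t).continuousAt
  have hvc : Continuous v := continuous_iff_continuousAt.2 fun t => (hv t).continuousAt
  have hcc : Continuous fun θ => v' θ * E θ + v θ * E' θ := (hv'c.mul hEc).add (hvc.mul hE'c)
  have h0 : (∫ θ in a..b, (v' θ * E θ + v θ * E' θ)) = 0 := by
    rw [intervalIntegral.integral_eq_sub_of_hasDerivAt (fun θ _ => (hv θ).mul (hE θ))
      (hcc.intervalIntegrable _ _)]
    simp [hper]
  have h1 : (∫ θ in a..b, E θ) = ∫ θ in a..b, (E θ - (v' θ * E θ + v θ * E' θ)) := by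
    rw [intervalIntegral.integral_sub (hEc.intervalIntegrable _ _) (hcc.intervalIntegrable _ _),
      h0, sub_zero]
  rw [h1]
  exact intervalIntegral.norm_integral_le_of_norm_le hab
    (Filter.Eventually.of_forall fun θ _ => hle θ) (hg.intervalIntegrable _ _)

/-- Algebraic form of the corrected amplitude in the phase identity for `besselJ`. -/
lemma norm_corrected_amplitude_le {x k y c s : ℝ} (hx : 240 ≤ x) (hk : 0 ≤ k) (hkx : 12 * k ≤ x)
    (hy : |y| ≤ 1) (hs : |s| ≤ 1) :
    ‖(1 : ℂ) -
        ((-Complex.I * ((-x * s * (x - (x * c + k) ^ 2) / ((x * c + k) ^ 2 + x) ^ 2 : ℝ) : ℂ)) +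
        (-Complex.I * (((x * c + k) / ((x * c + k) ^ 2 + x) : ℝ) : ℂ)) *
          (Complex.I * (x + y * Complex.I) * c + Complex.I * k))‖ ≤
      √2 * (x / ((x * c + k) ^ 2 + x)) + ((1 / √x) ^ 2 + 1 / 24 * (1 / √x)) := by
  have hx0 : 0 < x := by linarith
  have hr : 0 < √x := Real.sqrt_pos.2 hx0
  have hrr : √x ^ 2 = x := Real.sq_sqrt hx0.le
  set p := x * c + k with hp
  have hD0 : 0 < p ^ 2 + x := by positivity
  have hmain : |-x * s * (x - p ^ 2) / (p ^ 2 + x) ^ 2| ≤ x / (p ^ 2 + x) := by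
    rw [abs_div, abs_mul, abs_mul, abs_neg, abs_of_pos hx0, abs_of_pos (pow_pos hD0 2),
      div_le_div_iff₀ (pow_pos hD0 2) hD0]
    have h1 : |x - p ^ 2| ≤ p ^ 2 + x := abs_le.2 ⟨by nlinarith, by nlinarith [sq_nonneg p]⟩
    have h2 : x * |s| * |x - p ^ 2| ≤ x * 1 * (p ^ 2 + x) := by gcongr
    calc _ ≤ x * 1 * (p ^ 2 + x) * (p ^ 2 + x) := by gcongr
      _ = _ := by ring
  have hsecond : |p * (y * c) / (p ^ 2 + x)| ≤ (1 / √x) ^ 2 + 1 / 24 * (1 / √x) := by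
    rw [abs_div, abs_of_pos hD0, div_le_iff₀ hD0, abs_mul, abs_mul]
    have hc : x * |c| ≤ |p| + k := by
      have : x * |c| = |p - k| := by rw [hp, add_sub_cancel_right, abs_mul, abs_of_pos hx0]
      rw [this]
      exact (abs_sub _ _).trans (by rw [abs_of_nonneg hk])
    have h1 : |p| * (|y| * |c|) ≤ |p| * |c| := by
      have := mul_le_mul_of_nonneg_right hy (abs_nonneg c)
      rw [one_mul] at this
      gcongr
    have h2 : 2 * √x * |p| ≤ p ^ 2 + x := by
      nlinarith [sq_nonneg (√x - |p|), sq_abs p]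
    have h3 : |p| * |c| * x ≤ p ^ 2 + x / 12 * |p| := by
      nlinarith [abs_nonneg p, sq_abs p, mul_le_mul_of_nonneg_left hc (abs_nonneg p),
        mul_le_mul_of_nonneg_left hkx (abs_nonneg p)]
    have h4 : |p| * |c| ≤ (p ^ 2 + x) / x + 1 / 12 * |p| := by
      rw [← sub_nonneg]
      have : (p ^ 2 + x) / x + 1 / 12 * |p| - |p| * |c| =
        (x + (p ^ 2 + x / 12 * |p| - |p| * |c| * x)) / x := by field_simp; ring
      rw [this]
      exact div_nonneg (by linarith) hx0.le
    have h5 : |p| ≤ (p ^ 2 + x) / (2 * √x) := by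
      rw [le_div_iff₀ (by positivity)]; linarith
    calc |p| * (|y| * |c|) ≤ (p ^ 2 + x) / x + 1 / 12 * ((p ^ 2 + x) / (2 * √x)) := by linarith
      _ = ((1 / √x) ^ 2 + 1 / 24 * (1 / √x)) * (p ^ 2 + x) := by
        rw [div_pow, hrr]; field_simp; ring
  set m := -x * s * (x - p ^ 2) / (p ^ 2 + x) ^ 2 with hm
  have hsplit : (1 : ℂ) - ((-Complex.I * (m : ℂ)) + (-Complex.I * ((p / (p ^ 2 + x) : ℝ) : ℂ)) *
          (Complex.I * (x + y * Complex.I) * c + Complex.I * k)) =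
      (((x / (p ^ 2 + x) : ℝ) : ℂ) + (m : ℂ) * Complex.I) -
        ((p * (y * c) / (p ^ 2 + x) : ℝ) : ℂ) * Complex.I := by
    have h1 : (x : ℂ) / ((p : ℂ) ^ 2 + x) = 1 - (p : ℂ) * p / ((p : ℂ) ^ 2 + x) := by
      have : ((p : ℂ) ^ 2 + x) ≠ 0 := by exact_mod_cast hD0.ne'
      field_simp
      ring
    have h2 : (p : ℂ) = x * c + k := by rw [hp]; push_cast; ring
    push_cast
    rw [h1]
    generalize hq : (p : ℂ) / ((p : ℂ) ^ 2 + x) = q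
    have h3 : (p : ℂ) * p / ((p : ℂ) ^ 2 + x) = q * (x * c + k) := by
      rw [← hq, ← h2]; ring
    have h4 : (p : ℂ) * (y * c) / ((p : ℂ) ^ 2 + x) = q * (y * c) := by rw [← hq]; ring
    rw [h3, h4]
    linear_combination (q * (x * c + k) + q * y * c * Complex.I) * Complex.I_sq
  rw [hsplit]
  refine (norm_sub_le _ _).trans (add_le_add ?_ ?_)
  · have hpos : 0 ≤ x / (p ^ 2 + x) := by positivity
    rw [Complex.norm_add_mul_I]
    have h1 : m ^ 2 ≤ (x / (p ^ 2 + x)) ^ 2 := by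
      rw [← sq_abs m]; gcongr
    calc √((x / (p ^ 2 + x)) ^ 2 + m ^ 2) ≤ √(2 * (x / (p ^ 2 + x)) ^ 2) :=
          Real.sqrt_le_sqrt (by linarith)
      _ = √2 * (x / (p ^ 2 + x)) := by
          rw [Real.sqrt_mul (by norm_num), Real.sqrt_sq hpos]
  · rw [norm_mul, Complex.norm_I, mul_one, Complex.norm_real, Real.norm_eq_abs]
    exact hsecond

/-- Uniform decay of `besselJ` near the positive real axis, away from the turning point. -/
lemma norm_besselJ_le {x y : ℝ} {k : ℤ} (hx : 240 ≤ x) (hk : 0 ≤ k) (hkx : 12 * (k : ℝ) ≤ x)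
    (hy : |y| ≤ 1) : ‖besselJ k (x + y * Complex.I)‖ ≤ 2.7 * (1 / √x) := by
  have hx0 : 0 < x := by linarith
  have hkr : (0 : ℝ) ≤ k := by exact_mod_cast hk
  have hr : 0 < √x := Real.sqrt_pos.2 hx0
  have hpi := Real.pi_pos
  have hD : ∀ θ, 0 < (x * Real.cos θ + k) ^ 2 + x := fun θ => by positivity
  set z : ℂ := x + y * Complex.I with hz
  set E : ℝ → ℂ := fun θ =>
    Complex.exp (Complex.I * z * (Real.sin θ : ℂ)) * Complex.exp (Complex.I * (k : ℂ) * (θ : ℂ))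
    with hEdef
  set v : ℝ → ℂ := fun θ =>
    -Complex.I * (((x * Real.cos θ + k) / ((x * Real.cos θ + k) ^ 2 + x) : ℝ) : ℂ) with hvdef
  set v' : ℝ → ℂ := fun θ => -Complex.I * ((-x * Real.sin θ * (x - (x * Real.cos θ + k) ^ 2) /
    ((x * Real.cos θ + k) ^ 2 + x) ^ 2 : ℝ) : ℂ) with hv'def
  set L : ℝ → ℂ := fun θ =>
    Complex.I * (x + y * Complex.I) * (Real.cos θ : ℂ) + Complex.I * ((k : ℝ) : ℂ) with hLdef
  set G : ℝ → ℝ := fun θ =>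
    √2 * (x / ((x * Real.cos θ + k) ^ 2 + x)) + ((1 / √x) ^ 2 + 1 / 24 * (1 / √x)) with hGdef
  have hG0 : ∀ θ, 0 ≤ G θ := fun θ => by
    have := hD θ
    simp only [hGdef]; positivity
  have hcR : Continuous fun θ : ℝ => x / ((x * Real.cos θ + k) ^ 2 + x) :=
    Continuous.div (by fun_prop) (by fun_prop) fun θ => (hD θ).ne'
  have hGc : Continuous G := (hcR.const_mul _).add continuous_const
  have hE : ∀ θ, HasDerivAt E (L θ * E θ) θ := fun θ => by
    have h1 : HasDerivAt (fun θ : ℝ => Complex.exp (Complex.I * z * (Real.sin θ : ℂ)))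
        (Complex.exp (Complex.I * z * (Real.sin θ : ℂ)) * (Complex.I * z * (Real.cos θ : ℂ))) θ :=
      ((Real.hasDerivAt_sin θ).ofReal_comp.const_mul _).cexp
    have h2 : HasDerivAt (fun θ : ℝ => Complex.exp (Complex.I * (k : ℂ) * (θ : ℂ)))
        (Complex.exp (Complex.I * (k : ℂ) * (θ : ℂ)) * (Complex.I * (k : ℂ) * ((1 : ℝ) : ℂ))) θ :=
      ((hasDerivAt_id θ).ofReal_comp.const_mul _).cexp
    refine (h1.mul h2).congr_deriv ?_
    simp only [hLdef, hEdef, hz]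
    push_cast
    ring
  have hEc : Continuous E := continuous_iff_continuousAt.2 fun t => (hE t).continuousAt
  have hv : ∀ θ, HasDerivAt v (v' θ) θ := fun θ => by
    have h1 : HasDerivAt (fun θ => x * Real.cos θ + k) (x * -Real.sin θ) θ :=
      ((Real.hasDerivAt_cos θ).const_mul x).add_const _
    refine (((h1.div ((h1.pow 2).add_const x) (hD θ).ne').ofReal_comp).const_mul
      (-Complex.I)).congr_deriv ?_
    simp only [hv'def]
    congr 3
    simp
    ring
  have hv'c : Continuous v' := by
    refine continuous_const.mul (Complex.continuous_ofReal.comp ?_)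
    exact Continuous.div (by fun_prop) (by fun_prop) fun θ => (pow_pos (hD θ) 2).ne'
  have hLc : Continuous L := by simp only [hLdef]; fun_prop
  have hEn : ∀ θ, ‖E θ‖ = Real.exp (-(y * Real.sin θ)) := fun θ => by
    simp [hEdef, hz, Complex.norm_exp, -Complex.ofReal_sin]
  have hosc := norm_integral_le_of_corrector (E := E) (E' := fun θ => L θ * E θ) (v := v)
    (v' := v') (g := fun θ => Real.exp (-(y * Real.sin θ)) * G θ) (a := 0) (b := 2 * Real.pi)
    (by positivity) hE hv (hLc.mul hEc) hv'c (by fun_prop)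
    (by
      have : Complex.exp (Complex.I * k * (2 * Real.pi)) = 1 := by
        rw [Complex.exp_eq_one_iff]; exact ⟨k, by ring⟩
      simp [hvdef, hEdef, this])
    (fun θ => by
      have h := norm_corrected_amplitude_le (c := Real.cos θ) (s := Real.sin θ) hx hkr hkx hy
        (Real.abs_sin_le_one θ)
      have e : E θ - (v' θ * E θ + v θ * (L θ * E θ)) = E θ * (1 - (v' θ + v θ * L θ)) := by ring
      rw [e, norm_mul, hEn]
      exact mul_le_mul_of_nonneg_left h (Real.exp_pos _).le)
  have hfold : (∫ θ in (0 : ℝ)..2 * Real.pi, Real.exp (-(y * Real.sin θ)) * G θ) =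
      ∫ θ in (0 : ℝ)..Real.pi, 2 * Real.cosh (y * Real.sin θ) * G θ := by
    have hc : Continuous fun θ => Real.exp (-(y * Real.sin θ)) * G θ := by fun_prop
    have hc' : Continuous fun θ => Real.exp (y * Real.sin θ) * G θ := by fun_prop
    rw [← intervalIntegral.integral_add_adjacent_intervals (hc.intervalIntegrable 0 Real.pi)
      (hc.intervalIntegrable Real.pi (2 * Real.pi))]
    have h1 : (∫ θ in Real.pi..2 * Real.pi, Real.exp (-(y * Real.sin θ)) * G θ) =
        ∫ θ in (0 : ℝ)..Real.pi, Real.exp (y * Real.sin θ) * G θ := by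
      have h2 := intervalIntegral.integral_comp_sub_left (a := 0) (b := Real.pi)
        (fun θ => Real.exp (-(y * Real.sin θ)) * G θ) (2 * Real.pi)
      rw [sub_zero, show 2 * Real.pi - Real.pi = Real.pi by ring] at h2
      rw [← h2]
      simp [hGdef, Real.sin_two_pi_sub, Real.cos_two_pi_sub]
    rw [h1, ← intervalIntegral.integral_add (hc.intervalIntegrable _ _)
      (hc'.intervalIntegrable _ _)]
    refine intervalIntegral.integral_congr fun θ _ => ?_
    simp only [Real.cosh_eq]
    ring
  have hcosh : Real.cosh 1 ≤ 1.55 := by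
    have h1 := Real.exp_one_lt_d9
    have h2 := Real.exp_one_gt_d9
    have h3 : Real.exp (-1) ≤ 1 / 2.7 := by
      rw [Real.exp_neg, ← one_div]
      exact one_div_le_one_div_of_le (by norm_num) (by linarith)
    rw [Real.cosh_eq]
    linarith
  have hbound : (∫ θ in (0 : ℝ)..Real.pi, 2 * Real.cosh (y * Real.sin θ) * G θ) ≤
      ∫ θ in (0 : ℝ)..Real.pi, 3.1 * G θ := by
    have hc : Continuous fun θ => 2 * Real.cosh (y * Real.sin θ) * G θ :=
      (continuous_const.mul (Real.continuous_cosh.comp (by fun_prop))).mul hGc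
    refine intervalIntegral.integral_mono_on hpi.le (hc.intervalIntegrable _ _)
      ((continuous_const.mul hGc).intervalIntegrable _ _) fun θ _ => ?_
    refine mul_le_mul_of_nonneg_right ?_ (hG0 θ)
    have h1 : Real.cosh (y * Real.sin θ) ≤ Real.cosh 1 := by
      rw [Real.cosh_le_cosh, abs_mul, abs_one]
      exact mul_le_one₀ hy (abs_nonneg _) (Real.abs_sin_le_one θ)
    linarith
  have hGi : (∫ θ in (0 : ℝ)..Real.pi, 3.1 * G θ) =
      3.1 * (√2 * (∫ θ in (0 : ℝ)..Real.pi, x / ((x * Real.cos θ + k) ^ 2 + x)) +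
        Real.pi * ((1 / √x) ^ 2 + 1 / 24 * (1 / √x))) := by
    rw [intervalIntegral.integral_const_mul]
    simp only [hGdef]
    rw [intervalIntegral.integral_add ((hcR.const_mul _).intervalIntegrable _ _)
      intervalIntegrable_const, intervalIntegral.integral_const_mul,
      intervalIntegral.integral_const, sub_zero, smul_eq_mul]
  have hres := integral_resonance_le hx hkr hkx
  have hs2 : √2 ≤ 1.4143 := by rw [Real.sqrt_le_iff]; norm_num
  have hsx : 1 / √x ≤ 0.0646 := by
    rw [div_le_iff₀ hr]
    have : (15.49 : ℝ) ≤ √x := Real.le_sqrt_of_sq_le (by norm_num; linarith)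
    linarith
  have hJ : ‖besselJ k z‖ = 1 / (2 * Real.pi) * ‖∫ θ in (0 : ℝ)..2 * Real.pi, E θ‖ := by
    rw [besselJ, norm_mul]
    congr 1
    simp [abs_of_pos hpi]
  rw [hJ, div_mul_eq_mul_div, one_mul, div_le_iff₀ (by positivity)]
  refine (hosc.trans ((hfold.le.trans hbound).trans hGi.le)).trans ?_
  set r := 1 / √x
  have hr0 : 0 < r := by positivity
  have h1 : √2 * (∫ θ in (0 : ℝ)..Real.pi, x / ((x * Real.cos θ + k) ^ 2 + x)) ≤
      1.4143 * (72 / 71 * (Real.pi * r * (1 + 2 * r))) :=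
    (mul_le_mul_of_nonneg_left hres (Real.sqrt_nonneg _)).trans
      (mul_le_mul_of_nonneg_right hs2 (by positivity))
  have h2 : r * r ≤ 0.0646 * r := mul_le_mul_of_nonneg_right hsx hr0.le
  have h3 : Real.pi * (r * r) ≤ Real.pi * (0.0646 * r) := mul_le_mul_of_nonneg_left h2 hpi.le
  have h4 : 0 < Real.pi * r := by positivity
  nlinarith

lemma differentiable_besselJ (k : ℤ) : Differentiable ℂ (besselJ k) := by
  intro z₀
  set F : ℂ → ℝ → ℂ := fun z θ =>
    Complex.exp (Complex.I * z * (Real.sin θ : ℂ)) * Complex.exp (Complex.I * (k : ℂ) * (θ : ℂ))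
    with hF
  set F' : ℂ → ℝ → ℂ := fun z θ => Complex.I * (Real.sin θ : ℂ) * F z θ with hF'
  have hFc : ∀ z, Continuous (F z) := fun z => by simp only [hF]; fun_prop
  have hF'c : ∀ z, Continuous (F' z) := fun z => by simp only [hF', hF]; fun_prop
  have h := intervalIntegral.hasDerivAt_integral_of_dominated_loc_of_deriv_le
    (μ := MeasureTheory.volume) (a := 0) (b := 2 * Real.pi) (F := F) (F' := F') (x₀ := z₀)
    (bound := fun _ => Real.exp (‖z₀‖ + 1)) (Metric.ball_mem_nhds z₀ one_pos)
    (Filter.Eventually.of_forall fun z => (hFc z).aestronglyMeasurable)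
    ((hFc z₀).intervalIntegrable _ _) (hF'c z₀).aestronglyMeasurable
    (Filter.Eventually.of_forall fun θ _ z hz => by
      have hs := Real.abs_sin_le_one θ
      have h1 : ‖Complex.exp (Complex.I * (k : ℂ) * (θ : ℂ))‖ = 1 := by
        simp [Complex.norm_exp]
      have h2 : ‖Complex.exp (Complex.I * z * (Real.sin θ : ℂ))‖ ≤ Real.exp (‖z₀‖ + 1) := by
        refine (Complex.norm_exp_le_exp_norm _).trans (Real.exp_le_exp.2 ?_)
        rw [norm_mul, norm_mul, Complex.norm_I, one_mul, Complex.norm_real, Real.norm_eq_abs]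
        have h3 : ‖z‖ ≤ ‖z₀‖ + 1 := by
          have := norm_sub_norm_le z z₀
          rw [mem_ball_iff_norm] at hz
          linarith
        exact (mul_le_of_le_one_right (norm_nonneg _) hs).trans h3
      simp only [hF', hF]
      rw [norm_mul, norm_mul, norm_mul, h1, Complex.norm_I, one_mul, mul_one, Complex.norm_real,
        Real.norm_eq_abs]
      exact (mul_le_of_le_one_left (norm_nonneg _) hs).trans h2)
    intervalIntegrable_const
    (Filter.Eventually.of_forall fun θ _ z _ => by
      have h1 : HasDerivAt (fun z : ℂ => Complex.I * z * (Real.sin θ : ℂ))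
          (Complex.I * 1 * (Real.sin θ : ℂ)) z :=
        ((hasDerivAt_id z).const_mul _).mul_const _
      refine (h1.cexp.mul_const _).congr_deriv ?_
      simp only [hF', hF]
      ring)
  exact (h.2.const_mul (1 / (2 * (Real.pi : ℂ)))).differentiableAt

/-- Bound for `z ∏ J` obtained from six factors of size `|z|^{-1/2}`. -/
lemma norm_mul_prod_besselJ_le {z : ℂ} {k : Fin 6 → ℤ} (hre : 240 ≤ z.re)
    (him : |z.im| ≤ 1) (hk : ∀ j, 0 ≤ k j) (hkz : ∀ j, 12 * (k j : ℝ) ≤ z.re) :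
    ‖z * ∏ j, besselJ (k j) z‖ ≤ 3.36 ^ 6 / z.re ^ 2 := by
  have hx0 : 0 < z.re := by linarith
  have hJ : ∀ j, ‖besselJ (k j) z‖ ≤ 2.7 * (1 / √z.re) := fun j => by
    have := norm_besselJ_le hre (hk j) (hkz j) him
    rwa [Complex.re_add_im] at this
  have hz : ‖z‖ ≤ z.re + 1 := by
    refine (Complex.norm_le_abs_re_add_abs_im z).trans ?_
    rw [abs_of_pos hx0]
    linarith
  have hsq : √z.re ^ 2 = z.re := Real.sq_sqrt hx0.le
  rw [norm_mul, norm_prod]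
  have h1 : ∏ j, ‖besselJ (k j) z‖ ≤ (2.7 * (1 / √z.re)) ^ 6 := by
    refine (Finset.prod_le_prod (fun _ _ => norm_nonneg _) fun j _ => hJ j).trans_eq ?_
    simp
  calc ‖z‖ * ∏ j, ‖besselJ (k j) z‖ ≤ (z.re + 1) * (2.7 * (1 / √z.re)) ^ 6 := by gcongr
    _ = 2.7 ^ 6 * (z.re + 1) / z.re ^ 3 := by
      have : (√z.re) ^ 6 = z.re ^ 3 := by
        rw [show (6 : ℕ) = 2 * 3 from rfl, pow_mul, hsq]
      rw [mul_pow, div_pow, this]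
      ring
    _ ≤ 3.36 ^ 6 / z.re ^ 2 := by
      rw [div_le_div_iff₀ (by positivity) (by positivity)]
      have : 2.7 ^ 6 * (z.re + 1) ≤ 3.36 ^ 6 * z.re := by norm_num; linarith
      calc _ ≤ 3.36 ^ 6 * z.re * z.re ^ 2 := by gcongr
        _ = _ := by ring

lemma twelve_mul_le_of_twenty_le {N : ℝ} (hN : 20 ≤ N) :
    12 * N ≤ 0.95 * N ^ ((3 : ℝ) / 2) * Real.log N := by
  have hN0 : 0 < N := by linarith
  have h1 : N ^ ((3 : ℝ) / 2) = N * √N := by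
    rw [show (3 : ℝ) / 2 = 1 + 1 / 2 by norm_num, Real.rpow_add hN0, Real.rpow_one,
      Real.sqrt_eq_rpow]
  have h2 : (4.47 : ℝ) ≤ √N := Real.le_sqrt_of_sq_le (by norm_num; linarith)
  have h3 : (2.9 : ℝ) ≤ Real.log N := by
    have h4 : Real.log 20 = 4 * Real.log 2 + Real.log (5 / 4) := by
      rw [show (20 : ℝ) = 2 ^ 4 * (5 / 4) by norm_num, Real.log_mul (by norm_num) (by norm_num),
        Real.log_pow]
      norm_num
    have h5 := Real.one_sub_inv_le_log_of_pos (show (0 : ℝ) < 5 / 4 by norm_num)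
    have h6 := Real.log_two_gt_d9
    have h7 := Real.log_le_log (by norm_num) hN
    norm_num at h5
    linarith
  rw [h1]
  have h8 : (4.47 : ℝ) * 2.9 ≤ √N * Real.log N := by gcongr
  nlinarith

/-- Gauss quadrature error on `[a - d, a + d]` for an entire function whose derivative of order
`2 * n` is bounded there. -/
lemma norm_quadrature_error_le {n : ℕ} (hn : 1 ≤ n) {x w : Fin n → ℝ}
    (hx : Function.Injective x) (hmem : ∀ i, x i ∈ Set.Icc (-1 : ℝ) 1)
    (hw : ∀ q : ℝ[X], q.natDegree ≤ 2 * n - 1 →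
      (∫ y in (-1 : ℝ)..1, q.eval y) = ∑ i, w i * q.eval (x i))
    {f : ℂ → ℂ} (hf : Differentiable ℂ f) {a d M : ℝ} (hd : 0 ≤ d) (hM : 0 ≤ M)
    (hbound : ∀ t ∈ Set.Icc (a - d) (a + d),
      ‖iteratedDeriv (2 * n) f (t : ℂ)‖ ≤ (2 * n).factorial * M) :
    ‖(∫ t in (a - d)..(a + d), f (t : ℂ)) - d * ∑ i, (w i : ℂ) * f ((a + d * x i : ℝ) : ℂ)‖ ≤
      d * (d ^ (2 * n) * M * (Real.pi / 4 ^ n)) := by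
  have hfc : Continuous fun y : ℝ => f ((a + d * y : ℝ) : ℂ) :=
    hf.continuous.comp (by fun_prop)
  have hscale : (∫ t in (a - d)..(a + d), f (t : ℂ)) =
      d * ∫ y in (-1 : ℝ)..1, f ((a + d * y : ℝ) : ℂ) := by
    have := intervalIntegral.smul_integral_comp_add_mul (a := -1) (b := 1)
      (fun t : ℝ => f (t : ℂ)) d a
    rw [mul_neg_one, mul_one, ← sub_eq_add_neg] at this
    rw [← this, Complex.real_smul]
  rw [hscale, ← mul_sub, norm_mul, Complex.norm_real, Real.norm_of_nonneg hd]
  refine mul_le_mul_of_nonneg_left ?_ hd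
  set R := (∫ y in (-1 : ℝ)..1, f ((a + d * y : ℝ) : ℂ)) -
    ∑ i, (w i : ℂ) * f ((a + d * x i : ℝ) : ℂ) with hR
  have hder : ∀ (c : ℂ) (j : ℕ) (t : ℝ),
      HasDerivAt (fun y : ℝ => d ^ j * (c * iteratedDeriv j f ((a + d * y : ℝ) : ℂ)).re)
        (d ^ (j + 1) * (c * iteratedDeriv (j + 1) f ((a + d * t : ℝ) : ℂ)).re) t := by
    intro c j t
    have h1 : HasDerivAt (iteratedDeriv j f) (iteratedDeriv (j + 1) f ((a + d * t : ℝ) : ℂ))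
        ((a + d * t : ℝ) : ℂ) := by
      rw [iteratedDeriv_succ]
      exact ((hf.contDiff (n := ⊤)).differentiable_iteratedDeriv j
        (by exact_mod_cast WithTop.coe_lt_top _) _).hasDerivAt
    have h2 : HasDerivAt (fun y : ℝ => ((a + d * y : ℝ) : ℂ)) ((d * 1 : ℝ) : ℂ) t :=
      (((hasDerivAt_id t).const_mul d).const_add a).ofReal_comp
    have h3 : HasDerivAt (fun y : ℝ => c * iteratedDeriv j f ((a + d * y : ℝ) : ℂ))
        (c * (iteratedDeriv (j + 1) f ((a + d * t : ℝ) : ℂ) * ((d * 1 : ℝ) : ℂ))) t :=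
      (HasDerivAt.comp (h₂ := iteratedDeriv j f) (h := fun y : ℝ => ((a + d * y : ℝ) : ℂ))
        t h1 h2).const_mul c
    have h4 := (Complex.reCLM.hasFDerivAt.comp_hasDerivAt t h3).const_mul (d ^ j)
    refine h4.congr_deriv ?_
    have : c * (iteratedDeriv (j + 1) f ((a + d * t : ℝ) : ℂ) * ((d * 1 : ℝ) : ℂ)) =
        (d : ℂ) * (c * iteratedDeriv (j + 1) f ((a + d * t : ℝ) : ℂ)) := by push_cast; ring
    rw [this, Complex.reCLM_apply, Complex.re_ofReal_mul]
    ring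
  have hreal : ∀ c : ℂ, ‖c‖ ≤ 1 → |(c * R).re| ≤ d ^ (2 * n) * M * (Real.pi / 4 ^ n) := by
    intro c hc
    have h1 := abs_quadrature_error_le hn hx hmem hw _ (hder c) (B := d ^ (2 * n) * M)
      (fun t ht => by
        have h2 : a + d * t ∈ Set.Icc (a - d) (a + d) := by
          constructor <;> nlinarith [ht.1, ht.2]
        have h3 : ‖c * iteratedDeriv (2 * n) f ((a + d * t : ℝ) : ℂ)‖ ≤
            (2 * n).factorial * M := by
          rw [norm_mul]
          exact (mul_le_of_le_one_left (norm_nonneg _) hc).trans (hbound _ h2)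
        rw [abs_mul, abs_of_nonneg (by positivity : 0 ≤ d ^ (2 * n))]
        calc _ ≤ d ^ (2 * n) * ((2 * n).factorial * M) :=
              mul_le_mul_of_nonneg_left ((Complex.abs_re_le_norm _).trans h3) (by positivity)
          _ = _ := by ring)
    have h4 : (c * R).re = (∫ y in (-1 : ℝ)..1,
          d ^ 0 * (c * iteratedDeriv 0 f ((a + d * y : ℝ) : ℂ)).re) -
        ∑ i, w i * (d ^ 0 * (c * iteratedDeriv 0 f ((a + d * x i : ℝ) : ℂ)).re) := by
      simp only [pow_zero, one_mul, iteratedDeriv_zero]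
      rw [hR, mul_sub, Complex.sub_re, Finset.mul_sum, Complex.re_sum,
        ← intervalIntegral.integral_const_mul]
      congr 1
      · exact (Complex.reCLM.intervalIntegral_comp_comm
          ((continuous_const.mul hfc).intervalIntegrable _ _)).symm
      · refine Finset.sum_congr rfl fun i _ => ?_
        rw [mul_left_comm, Complex.re_ofReal_mul]
    rw [h4]
    exact h1.trans (mul_le_mul_of_nonneg_left (integral_nodal_sq_le hn hw) (by positivity))
  rcases eq_or_ne R 0 with h0 | h0
  · rw [h0, norm_zero]; positivity
  · have h1 := hreal ((starRingEnd ℂ) R / ‖R‖) (by simp [h0])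
    have h2 : (starRingEnd ℂ) R / ‖R‖ * R = (‖R‖ : ℂ) := by
      have : (‖R‖ : ℂ) ≠ 0 := by exact_mod_cast norm_ne_zero_iff.2 h0
      rw [div_mul_eq_mul_div, Complex.conj_mul', sq, mul_div_assoc, div_self this, mul_one]
    rw [h2, Complex.ofReal_re, abs_norm] at h1
    exact h1

/-- Telescoping comparison for a sum of inverse squares along an arithmetic progression. -/
lemma sum_div_sq_le {A d : ℝ} (hd : 0 < d) (hA : 0 < A - 2 * d) (K : ℕ) :
    ∑ j ∈ Finset.range K, d / (A + 2 * d * j) ^ 2 ≤ 1 / 2 * (A - 2 * d)⁻¹ := by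
  have hpos : ∀ j : ℕ, 0 < A - 2 * d + 2 * d * j := fun j => by positivity
  have hterm : ∀ j : ℕ, d / (A + 2 * d * j) ^ 2 ≤
      1 / 2 * (A - 2 * d + 2 * d * j)⁻¹ - 1 / 2 * (A - 2 * d + 2 * d * (j + 1 : ℕ))⁻¹ := by
    intro j
    have h1 := hpos j
    have h2 : A - 2 * d + 2 * d * (j + 1 : ℕ) = A + 2 * d * j := by push_cast; ring
    rw [h2]
    set p := A - 2 * d + 2 * d * j with hp
    have h3 : A + 2 * d * j = p + 2 * d := by rw [hp]; ring
    rw [h3]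
    have h4 : 1 / 2 * p⁻¹ - 1 / 2 * (p + 2 * d)⁻¹ = d / (p * (p + 2 * d)) := by
      have : p + 2 * d ≠ 0 := by positivity
      field_simp
      ring
    rw [h4, sq]
    gcongr
    linarith
  refine (Finset.sum_le_sum fun j _ => hterm j).trans ?_
  rw [Finset.sum_range_sub']
  have := inv_pos.2 (hpos K)
  simp only [Nat.cast_zero, mul_zero, add_zero]
  linarith

/-- Quadrature error on `[S,T]` for `f(z) = z ∏_{j=1}^{6} J_{k_j}(z)` with
`0 ≤ k_j ≤ N`, `N ≥ 20`: cutting `[S,T]` into `K` intervals of length `2d = (T−S)/K` and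
using `n`-point Gauss–Legendre quadrature on each, the error is at most
`π 2^{−2n−1} d^{2n} (3.36)⁶ (S−1−2d)^{−1}`. -/
theorem quadrature_error_S_T (n : ℕ) (hn : 1 ≤ n) (x w : Fin n → ℝ)
    (hmono : StrictMono x) (hmem : ∀ i, x i ∈ Set.Ioo (-1:ℝ) 1)
    (hroot : ∀ i, (legendreMonic n).eval (x i) = 0)
    (hweights : ∀ q : Polynomial ℝ, q.natDegree ≤ 2 * n - 1 →
      (∫ y in (-1:ℝ)..1, q.eval y) = ∑ i : Fin n, w i * q.eval (x i))
    (N : ℕ) (hN : 20 ≤ N) (k : Fin 6 → ℤ) (hk : ∀ j, 0 ≤ k j ∧ k j ≤ (N : ℤ))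
    (K : ℕ) (hK : 1 ≤ K) (S T : ℝ)
    (hS : 0.95 * (N : ℝ) ^ ((3 : ℝ) / 2) * Real.log N + 1 ≤ S) (hST : S < T)
    (d : ℝ) (hd : d = (T - S) / (2 * K)) (hSd : 0 < S - 1 - 2 * d) :
    ‖(∫ t in S..T, (t : ℂ) * ∏ j, besselJ (k j) (t : ℂ)) -
        ∑ j ∈ Finset.range K, (d : ℂ) *
          ∑ i : Fin n, (w i : ℂ) *
            (((S + d * (2 * j + 1) + d * x i : ℝ) : ℂ) *
              ∏ l, besselJ (k l) ((S + d * (2 * j + 1) + d * x i : ℝ) : ℂ))‖ ≤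
      Real.pi * (2:ℝ) ^ (-(2 * (n:ℤ)) - 1) * d ^ (2 * n) * 3.36 ^ 6 *
        (S - 1 - 2 * d)⁻¹ := by
  have hn20 : (20 : ℝ) ≤ N := by exact_mod_cast hN
  have hthr := twelve_mul_le_of_twenty_le hn20
  have hK0 : (0 : ℝ) < K := by exact_mod_cast hK
  have hd0 : 0 < d := by rw [hd]; exact div_pos (sub_pos.2 hST) (by positivity)
  have hT : S + 2 * d * K = T := by rw [hd]; field_simp; ring
  set f : ℂ → ℂ := fun z => z * ∏ j, besselJ (k j) z with hfdef
  have hf : Differentiable ℂ f :=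
    differentiable_id.mul (Differentiable.fun_finsetProd fun j _ => differentiable_besselJ (k j))
  have hcauchy : ∀ t : ℝ, S ≤ t →
      ‖iteratedDeriv (2 * n) f (t : ℂ)‖ ≤ (2 * n).factorial * (3.36 ^ 6 / (t - 1) ^ 2) := by
    intro t ht
    have h := Complex.norm_iteratedDeriv_le_of_forall_mem_sphere_norm_le (2 * n) (c := (t : ℂ))
      (R := 1) (C := 3.36 ^ 6 / (t - 1) ^ 2) one_pos hf.diffContOnCl fun z hz => by
        have hz1 : ‖z - t‖ = 1 := by simpa using hz
        have hre := (Complex.abs_re_le_norm (z - t)).trans_eq hz1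
        have him := (Complex.abs_im_le_norm (z - t)).trans_eq hz1
        simp only [Complex.sub_re, Complex.ofReal_re, Complex.sub_im, Complex.ofReal_im,
          sub_zero] at hre him
        have hre' : t - 1 ≤ z.re := by linarith [(abs_le.1 hre).1]
        refine (norm_mul_prod_besselJ_le (by linarith) him (fun j => (hk j).1) fun j => ?_).trans ?_
        · have : (k j : ℝ) ≤ N := by exact_mod_cast (hk j).2
          linarith
        · have : 0 < t - 1 := by linarith
          gcongr
    simpa [mul_div_assoc] using h
  have hpiece : ∀ j : ℕ, ‖(∫ t in (S + 2 * d * j)..(S + 2 * d * (j + 1 : ℕ)), f (t : ℂ)) -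
      d * ∑ i, (w i : ℂ) * f ((S + d * (2 * j + 1) + d * x i : ℝ) : ℂ)‖ ≤
      (d ^ (2 * n) * 3.36 ^ 6 * (Real.pi / 4 ^ n)) * (d / (S - 1 + 2 * d * j) ^ 2) := by
    intro j
    have hj : 0 ≤ 2 * d * j := by positivity
    have h := norm_quadrature_error_le hn hmono.injective (fun i => Set.Ioo_subset_Icc_self (hmem i))
      hweights hf (a := S + d * (2 * j + 1)) (d := d) (M := 3.36 ^ 6 / (S - 1 + 2 * d * j) ^ 2)
      hd0.le (by positivity) fun t ht => by
        have ht1 := ht.1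
        refine (hcauchy t (by linarith)).trans ?_
        have : 0 < S - 1 + 2 * d * j := by linarith
        gcongr
        linarith
    rw [show S + d * (2 * j + 1) - d = S + 2 * d * j by ring,
      show S + d * (2 * j + 1) + d = S + 2 * d * (j + 1 : ℕ) by push_cast; ring] at h
    refine h.trans_eq ?_
    ring
  have hsplit : (∫ t in S..T, f (t : ℂ)) = ∑ j ∈ Finset.range K,
      ∫ t in (S + 2 * d * j)..(S + 2 * d * (j + 1 : ℕ)), f (t : ℂ) := by
    have hfc : Continuous fun t : ℝ => f t := hf.continuous.comp Complex.continuous_ofReal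
    rw [intervalIntegral.sum_integral_adjacent_intervals (a := fun j : ℕ => S + 2 * d * j)
      fun j _ => hfc.intervalIntegrable _ _]
    simp [hT]
  change ‖(∫ t in S..T, f (t : ℂ)) - ∑ j ∈ Finset.range K, (d : ℂ) *
    ∑ i, (w i : ℂ) * f ((S + d * (2 * j + 1) + d * x i : ℝ) : ℂ)‖ ≤ _
  rw [hsplit, ← Finset.sum_sub_distrib]
  refine ((norm_sum_le _ _).trans (Finset.sum_le_sum fun j _ => hpiece j)).trans ?_
  rw [← Finset.mul_sum]
  refine (mul_le_mul_of_nonneg_left (sum_div_sq_le hd0 hSd K) (by positivity)).trans_eq ?_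
  have h2 : (2 : ℝ) ^ (-(2 * (n : ℤ)) - 1) = 1 / (2 * 4 ^ n) := by
    rw [zpow_sub₀ two_ne_zero, zpow_neg, zpow_mul, zpow_natCast]
    norm_num
    ring
  rw [h2]
  field_simp
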